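/- For every ε > 0 there exists a nonempty compact strongly invisible set C ⊆ ℝ with diam C < ε. -/

import Mathlib

open Set MeasureTheory

/-- `C` is σ-finite with respect to `μ`: `C` is a countable union of Borel sets of finite
`μ`-measure. -/
def SigmaFiniteOn {G : Type*} [MeasurableSpace G] (μ : MeasureTheory.Measure G)
    (C : Set G) : Prop :=
  ∃ s : ℕ → Set G, C = (⋃ n, s n) ∧ ∀ n, MeasurableSet (s n) ∧ μ (s n) < ⊤

/-- `C` is strongly invisible: for every translation-invariant Borel measure `μ`,
either `μ C = 0` or `C` is not σ-finite with respect to `μ`. -/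
def StronglyInvisible {G : Type*} [MeasurableSpace G] [AddCommGroup G] (C : Set G) : Prop :=
  ∀ μ : MeasureTheory.Measure G,
    (∀ (t : G) (A : Set G), MeasurableSet A → μ ((fun x => x + t) '' A) = μ A) →
    μ C = 0 ∨ ¬ SigmaFiniteOn μ C

/-- A Borel set with uncountably many pairwise disjoint translates inside a set that is σ-finite
for a translation-invariant measure is null. -/
theorem measure_eq_zero_of_disjoint_translates {ι : Type*} [Uncountable ι] {μ : Measure ℝ}
    (hμ : ∀ (t : ℝ) (A : Set ℝ), MeasurableSet A → μ ((fun x => x + t) '' A) = μ A)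
    {B C : Set ℝ} (hC : SigmaFiniteOn μ C) (hB : MeasurableSet B) (t : ι → ℝ)
    (hsub : ∀ i, (fun x => x + t i) '' B ⊆ C)
    (hdisj : Pairwise (Function.onFun Disjoint fun i => (fun x => x + t i) '' B)) :
    μ B = 0 := by
  obtain ⟨s, rfl, hs⟩ := hC
  have hmeas : ∀ i, MeasurableSet ((fun x => x + t i) '' B) := fun i =>
    (MeasurableEquiv.addRight (t i)).measurableSet_image.2 hB
  have hcount : (⋃ n, {i | 0 < μ.restrict (s n) ((fun x => x + t i) '' B)}).Countable := by
    refine countable_iUnion fun n => ?_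
    have : IsFiniteMeasure (μ.restrict (s n)) := ⟨by simpa using (hs n).2⟩
    exact Measure.countable_meas_pos_of_disjoint_iUnion hmeas hdisj
  obtain ⟨i, hi⟩ : ∃ i, i ∉ ⋃ n, {i | 0 < μ.restrict (s n) ((fun x => x + t i) '' B)} := by
    by_contra! h
    exact not_countable_univ (hcount.mono fun i _ => h i)
  rw [← hμ (t i) B hB, ← inter_eq_left.2 (hsub i), inter_iUnion, measure_iUnion_null_iff]
  intro n
  have : i ∉ {i | 0 < μ.restrict (s n) ((fun x => x + t i) '' B)} := fun h =>
    hi (mem_iUnion.2 ⟨n, h⟩)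
  rwa [mem_ofPred, not_lt, nonpos_iff_eq_zero, Measure.restrict_apply (hmeas i)] at this

/-- The weights of a mixed-radix expansion with leading weight `ε`, decreasing so fast that
sequences of digits `x k < 2 ^ k` are determined by the sum of their expansion. -/
noncomputable def weight (ε : ℝ) : ℕ → ℝ
  | 0 => ε
  | k + 1 => weight ε k / 2 ^ (k + 3)

theorem weight_pos {ε : ℝ} (hε : 0 < ε) (k : ℕ) : 0 < weight ε k := by
  induction k with
  | zero => exact hε
  | succ k ih => rw [weight]; positivity

theorem two_pow_mul_weight_succ (ε : ℝ) (k : ℕ) :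
    2 ^ (k + 1) * weight ε (k + 1) = weight ε k / 4 := by
  rw [weight]
  field_simp
  ring

theorem two_pow_mul_weight_add_le {ε : ℝ} (hε : 0 < ε) (i j : ℕ) :
    2 ^ (j + (i + 1)) * weight ε (j + (i + 1)) ≤ weight ε i / 4 * (1 / 4) ^ j := by
  induction j with
  | zero => simp [two_pow_mul_weight_succ]
  | succ j ih =>
    have h := two_pow_mul_weight_succ ε (j + (i + 1))
    have h1 : weight ε (j + (i + 1)) ≤ 2 ^ (j + (i + 1)) * weight ε (j + (i + 1)) :=
      le_mul_of_one_le_left (weight_pos hε _).le (one_le_pow₀ one_le_two)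
    rw [show j + 1 + (i + 1) = j + (i + 1) + 1 by ring, h, pow_succ]
    linarith

theorem abs_mul_weight_le {ε : ℝ} (hε : 0 < ε) {d : ℕ → ℝ} (hd : ∀ k, |d k| ≤ 2 ^ k) (k : ℕ) :
    ‖d k * weight ε k‖ ≤ 2 ^ k * weight ε k := by
  rw [Real.norm_eq_abs, abs_mul, abs_of_pos (weight_pos hε k)]
  exact mul_le_mul_of_nonneg_right (hd k) (weight_pos hε k).le

theorem summable_two_pow_mul_weight {ε : ℝ} (hε : 0 < ε) :
    Summable fun k => 2 ^ k * weight ε k := by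
  rw [← summable_nat_add_iff 1]
  exact Summable.of_nonneg_of_le (fun k => mul_nonneg (by positivity) (weight_pos hε _).le)
    (two_pow_mul_weight_add_le hε 0)
    ((summable_geometric_of_lt_one (by norm_num) (by norm_num)).mul_left _)

theorem summable_mul_weight {ε : ℝ} (hε : 0 < ε) {d : ℕ → ℝ} (hd : ∀ k, |d k| ≤ 2 ^ k) :
    Summable fun k => d k * weight ε k :=
  (summable_two_pow_mul_weight hε).of_norm_bounded (abs_mul_weight_le hε hd)

theorem abs_tsum_mul_weight_tail_le {ε : ℝ} (hε : 0 < ε) {d : ℕ → ℝ} (hd : ∀ k, |d k| ≤ 2 ^ k)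
    (i : ℕ) : |∑' j, d (j + (i + 1)) * weight ε (j + (i + 1))| ≤ weight ε i / 3 := by
  have hgeom : HasSum (fun j : ℕ => weight ε i / 4 * (1 / 4) ^ j) (weight ε i / 3) := by
    have h := (hasSum_geometric_of_lt_one (r := (1 / 4 : ℝ)) (by norm_num)
      (by norm_num)).mul_left (weight ε i / 4)
    rwa [show weight ε i / 4 * (1 - 1 / 4)⁻¹ = weight ε i / 3 by ring] at h
  exact tsum_of_norm_bounded hgeom fun j =>
    (abs_mul_weight_le hε hd _).trans (two_pow_mul_weight_add_le hε i j)

theorem eq_zero_of_tsum_mul_weight_eq_zero {ε : ℝ} (hε : 0 < ε) {d : ℕ → ℤ}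
    (hd : ∀ k, |(d k : ℝ)| ≤ 2 ^ k) (hsum : ∑' k, (d k : ℝ) * weight ε k = 0) : d = 0 := by
  by_contra hne
  have hex : ∃ k, d k ≠ 0 := by
    by_contra! h
    exact hne (funext h)
  classical
  set i := Nat.find hex
  have hi : d i ≠ 0 := Nat.find_spec hex
  have hlt : ∀ k < i, d k = 0 := fun k hk => not_not.1 (Nat.find_min hex hk)
  have hsplit := (summable_mul_weight hε hd).sum_add_tsum_nat_add (i + 1)
  rw [hsum, Finset.sum_range_succ, Finset.sum_eq_zero fun k hk => by
    simp [hlt k (Finset.mem_range.1 hk)], zero_add] at hsplit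
  have htail := abs_tsum_mul_weight_tail_le hε hd i
  rw [← neg_eq_of_add_eq_zero_right hsplit, abs_neg, abs_mul,
    abs_of_pos (weight_pos hε i)] at htail
  have h1 : (1 : ℝ) ≤ |(d i : ℝ)| := by exact_mod_cast Int.one_le_abs hi
  nlinarith [weight_pos hε i]

/-- Digit sequences in which all digits after a nonzero digit at position `i`, and that digit
itself, are less than `2 ^ i`. -/
def digitSet : Set (ℕ → ℕ) :=
  {x | ∀ i k, i ≤ k → x i ≠ 0 → x k < 2 ^ i}

/-- Digit sequences with digits less than `2 ^ m` whose first possibly nonzero digit is the digit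
`j` at position `m`. -/
def digitPiece (m j : ℕ) : Set (ℕ → ℕ) :=
  {x | (∀ i < m, x i = 0) ∧ x m = j ∧ ∀ k, x k < 2 ^ m}

/-- The real number with a given sequence of digits. -/
noncomputable def expansion (ε : ℝ) (x : ℕ → ℕ) : ℝ :=
  ∑' k, (x k : ℝ) * weight ε k

theorem lt_two_pow_of_mem_digitSet {x : ℕ → ℕ} (hx : x ∈ digitSet) (k : ℕ) : x k < 2 ^ k := by
  by_cases h : x k = 0
  · rw [h]; positivity
  · exact hx k k le_rfl h

theorem abs_cast_le_of_mem_digitSet {x : ℕ → ℕ} (hx : x ∈ digitSet) (k : ℕ) :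
    |((x k : ℕ) : ℝ)| ≤ 2 ^ k := by
  rw [Nat.abs_cast]
  exact_mod_cast (lt_two_pow_of_mem_digitSet hx k).le

theorem isClosed_digitSet : IsClosed digitSet := by
  simp only [digitSet, ofPred_forall]
  refine isClosed_iInter fun i => isClosed_iInter fun k => isClosed_iInter fun _ => ?_
  have hcont : Continuous fun x : ℕ → ℕ => (x i, x k) :=
    (continuous_apply i).prodMk (continuous_apply k)
  exact (isClosed_discrete {p : ℕ × ℕ | p.1 ≠ 0 → p.2 < 2 ^ i}).preimage hcont

theorem isCompact_digitSet : IsCompact digitSet :=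
  (isCompact_univ_pi fun k => (finite_Iio (2 ^ k)).isCompact).of_isClosed_subset
    isClosed_digitSet fun _ hx k _ => lt_two_pow_of_mem_digitSet hx k

theorem digitPiece_subset_digitSet (m j : ℕ) : digitPiece m j ⊆ digitSet := by
  intro x hx i k _ hi
  have hmi : m ≤ i := by
    by_contra! h
    exact hi (hx.1 i h)
  exact (hx.2.2 k).trans_le (Nat.pow_le_pow_right two_pos hmi)

theorem digitSet_eq_iUnion : digitSet = ⋃ m, ⋃ j, digitPiece m j := by
  refine Subset.antisymm (fun x hx => ?_)
    (iUnion_subset fun m => iUnion_subset fun j => digitPiece_subset_digitSet m j)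
  simp only [mem_iUnion]
  by_cases hex : ∃ k, x k ≠ 0
  · classical
    have hlt : ∀ k < Nat.find hex, x k = 0 := fun k hk => not_not.1 (Nat.find_min hex hk)
    refine ⟨Nat.find hex, _, hlt, rfl, fun k => ?_⟩
    rcases lt_or_ge k (Nat.find hex) with hk | hk
    · rw [hlt k hk]; positivity
    · exact hx _ k hk (Nat.find_spec hex)
  · push Not at hex
    exact ⟨0, 0, by simp, hex 0, by simp [hex]⟩

theorem isClosed_digitPiece (m j : ℕ) : IsClosed (digitPiece m j) := by
  have : digitPiece m j = (⋂ i, ⋂ _ : i < m, (fun x : ℕ → ℕ => x i) ⁻¹' {0}) ∩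
      ((fun x : ℕ → ℕ => x m) ⁻¹' {j} ∩ ⋂ k, (fun x : ℕ → ℕ => x k) ⁻¹' Iio (2 ^ m)) := by
    ext x
    simp [digitPiece]
  rw [this]
  exact (isClosed_iInter fun i => isClosed_iInter fun _ =>
    (isClosed_discrete _).preimage (continuous_apply i)).inter
    (((isClosed_discrete _).preimage (continuous_apply m)).inter
      (isClosed_iInter fun k => (isClosed_discrete _).preimage (continuous_apply k)))

theorem continuousOn_expansion {ε : ℝ} (hε : 0 < ε) : ContinuousOn (expansion ε) digitSet := by
  refine continuousOn_tsum (fun k => ?_) (summable_two_pow_mul_weight hε)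
    fun k x hx => abs_mul_weight_le hε (abs_cast_le_of_mem_digitSet hx) k
  exact ((continuous_of_discreteTopology (f := fun n : ℕ => (n : ℝ))).comp
    (continuous_apply k)).continuousOn.mul continuousOn_const

theorem injOn_expansion {ε : ℝ} (hε : 0 < ε) : InjOn (expansion ε) digitSet := by
  intro x hx y hy hxy
  have hsub := (summable_mul_weight hε (abs_cast_le_of_mem_digitSet hx)).tsum_sub
    (summable_mul_weight hε (abs_cast_le_of_mem_digitSet hy))
  have hd : (fun k => (x k : ℤ) - y k) = 0 := by
    refine eq_zero_of_tsum_mul_weight_eq_zero hε (fun k => ?_) ?_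
    · have h1 : (x k : ℝ) ≤ 2 ^ k := by exact_mod_cast (lt_two_pow_of_mem_digitSet hx k).le
      have h2 : (y k : ℝ) ≤ 2 ^ k := by exact_mod_cast (lt_two_pow_of_mem_digitSet hy k).le
      push_cast
      rw [abs_le]
      constructor <;> linarith [Nat.cast_nonneg (α := ℝ) (x k), Nat.cast_nonneg (α := ℝ) (y k)]
    · push_cast
      simp only [sub_mul]
      rw [hsub]
      exact sub_eq_zero.2 hxy
  funext k
  have := congrFun hd k
  simp only [Pi.zero_apply] at this
  omega

theorem expansion_mem_Icc {ε : ℝ} (hε : 0 < ε) {x : ℕ → ℕ} (hx : x ∈ digitSet) :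
    expansion ε x ∈ Icc 0 (ε / 3) := by
  refine ⟨tsum_nonneg fun k => mul_nonneg (Nat.cast_nonneg _) (weight_pos hε k).le, ?_⟩
  have h0 : x 0 = 0 := by simpa using lt_two_pow_of_mem_digitSet hx 0
  have htail := abs_tsum_mul_weight_tail_le hε (abs_cast_le_of_mem_digitSet hx) 0
  rw [expansion, (summable_mul_weight hε (abs_cast_le_of_mem_digitSet hx)).tsum_eq_zero_add, h0]
  simpa [weight] using (le_abs_self _).trans htail

/-- Erase the digit at position `m` and add `2 ^ m` to the later digits selected by `e`. -/
def shiftDigits (m : ℕ) (e : ℕ → Bool) (x : ℕ → ℕ) (k : ℕ) : ℕ :=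
  if k ≤ m then 0 else x k + if e (k - (m + 1)) then 2 ^ m else 0

theorem shiftDigits_mem_digitSet {m j : ℕ} {x : ℕ → ℕ} (hx : x ∈ digitPiece m j)
    (e : ℕ → Bool) : shiftDigits m e x ∈ digitSet := by
  intro i k _ hi
  have hmi : m + 1 ≤ i := by
    by_contra! h
    exact hi (if_pos (by omega))
  refine lt_of_lt_of_le ?_ (Nat.pow_le_pow_right two_pos hmi)
  have hk := hx.2.2 k
  have hpos : 0 < 2 ^ m := by positivity
  rw [shiftDigits, pow_succ]
  split_ifs <;> omega

theorem eq_of_shiftDigits_eq {m j : ℕ} {x y : ℕ → ℕ} (hx : x ∈ digitPiece m j)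
    (hy : y ∈ digitPiece m j) {e e' : ℕ → Bool} (h : shiftDigits m e x = shiftDigits m e' y) :
    e = e' := by
  funext i
  have hi := congrFun h (i + (m + 1))
  have h1 := hx.2.2 (i + (m + 1))
  have h2 := hy.2.2 (i + (m + 1))
  simp only [shiftDigits, show ¬ i + (m + 1) ≤ m by omega, if_false, Nat.add_sub_cancel] at hi
  cases he : e i <;> cases he' : e' i <;> simp [he, he'] at hi ⊢ <;> omega

/-- The translation that realizes `shiftDigits m e` on expansions of `digitPiece m j`. -/
noncomputable def shiftAmount (ε : ℝ) (m j : ℕ) (e : ℕ → Bool) : ℝ :=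
  ∑' k, (if k = m then -(j : ℝ) else if k < m then 0 else if e (k - (m + 1)) then 2 ^ m else 0) *
    weight ε k

theorem expansion_add_shiftAmount {ε : ℝ} (hε : 0 < ε) {m j : ℕ} {x : ℕ → ℕ}
    (hx : x ∈ digitPiece m j) (e : ℕ → Bool) :
    expansion ε x + shiftAmount ε m j e = expansion ε (shiftDigits m e x) := by
  have hsub := (summable_mul_weight hε
      (abs_cast_le_of_mem_digitSet (shiftDigits_mem_digitSet hx e))).tsum_sub
    (summable_mul_weight hε (abs_cast_le_of_mem_digitSet (digitPiece_subset_digitSet m j hx)))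
  rw [← eq_sub_iff_add_eq', expansion, expansion, ← hsub, shiftAmount]
  refine tsum_congr fun k => ?_
  rw [← sub_mul]
  congr 1
  rcases lt_trichotomy k m with hk | rfl | hk
  · simp [shiftDigits, hk, hk.le, hk.ne, hx.1 k hk]
  · simp [shiftDigits, hx.2.1]
  · simp [shiftDigits, hk.not_ge, hk.not_gt, hk.ne']

theorem stronglyInvisible_image_digitSet {ε : ℝ} (hε : 0 < ε) :
    StronglyInvisible (expansion ε '' digitSet) := by
  intro μ hμ
  refine or_iff_not_imp_right.2 fun hC => ?_
  rw [not_not] at hC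
  have himage : expansion ε '' digitSet = ⋃ m, ⋃ j, expansion ε '' digitPiece m j := by
    conv_lhs => rw [digitSet_eq_iUnion]
    simp only [image_iUnion]
  rw [himage]
  refine measure_iUnion_null fun m => measure_iUnion_null fun j => ?_
  have hsub := digitPiece_subset_digitSet m j
  have hcompact : IsCompact (expansion ε '' digitPiece m j) :=
    (isCompact_digitSet.of_isClosed_subset (isClosed_digitPiece m j) hsub).image_of_continuousOn
      ((continuousOn_expansion hε).mono hsub)
  have hunc : Uncountable (ℕ → Bool) := by
    rw [← Cardinal.aleph0_lt_mk_iff]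
    simpa using Cardinal.cantor Cardinal.aleph0
  refine measure_eq_zero_of_disjoint_translates hμ hC hcompact.measurableSet
    (shiftAmount ε m j) ?_ ?_
  · rintro e _ ⟨_, ⟨x, hx, rfl⟩, rfl⟩
    exact ⟨_, shiftDigits_mem_digitSet hx e, (expansion_add_shiftAmount hε hx e).symm⟩
  · intro e e' hne
    refine disjoint_left.2 ?_
    rintro _ ⟨_, ⟨x, hx, rfl⟩, rfl⟩ ⟨_, ⟨y, hy, rfl⟩, hxy⟩
    simp only [expansion_add_shiftAmount hε hx, expansion_add_shiftAmount hε hy] at hxy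
    exact hne (eq_of_shiftDigits_eq hx hy (injOn_expansion hε (shiftDigits_mem_digitSet hx e)
      (shiftDigits_mem_digitSet hy e') hxy.symm))

/-- There exist nonempty compact strongly invisible subsets of `ℝ` of
arbitrarily small diameter. -/
theorem stmt_17 (ε : ℝ) (hε : 0 < ε) :
    ∃ C : Set ℝ, C.Nonempty ∧ IsCompact C ∧ Metric.diam C < ε ∧ StronglyInvisible C := by
  refine ⟨expansion ε '' digitSet, ⟨_, 0, by simp [digitSet], rfl⟩,
    isCompact_digitSet.image_of_continuousOn (continuousOn_expansion hε), ?_,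
    stronglyInvisible_image_digitSet hε⟩
  have hsub : expansion ε '' digitSet ⊆ Icc 0 (ε / 3) :=
    image_subset_iff.2 fun x hx => expansion_mem_Icc hε hx
  refine (Metric.diam_mono hsub (Metric.isBounded_Icc _ _)).trans_lt ?_
  rw [Real.diam_Icc (by positivity)]
  linarith
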